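/- arXiv:1311.6607 — 4 statements merged into one kernel-verified Lean document; each statement's English description precedes it below -/
import Mathlib

section
/- Let α₀ ∈ (0,1) be the unique zero of T in (0,1). For every ε > 0 there exists δ > 0 such that for every α ∈ (α₀ − δ, α₀) and every τ ∈ (−1,0) with c(α,τ) = 0, one has τ > −ε. (This expresses the limit τ₁(α) → 0 as α → α₀⁻, where τ₁(α) is the unique zero of c(α,·) in (−1,0) for α ∈ (0,α₀).) -/
open MeasureTheory Real Set

noncomputable def c (α τ : ℝ) : ℝ :=
  ∫ t in Set.Ioi (0:ℝ), (|1 - t| ^ τ + (1 + t) ^ τ - 2) / t ^ (1 + 2 * α)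

noncomputable def T (α : ℝ) : ℝ :=
  ∫ t in Set.Ioi (0:ℝ), Real.log |1 - t ^ 2| / t ^ (1 + 2 * α)

theorem rpow_mul_sub_one_le {x : ℝ} (hx : 0 < x) (τ : ℝ) {l : ℝ} (h0 : 0 ≤ l) (h1 : l ≤ 1) :
    x ^ (l * τ) - 1 ≤ l * (x ^ τ - 1) := by
  have hp : 0 < x ^ τ := rpow_pos_of_pos hx τ
  have h := rpow_one_add_le_one_add_mul_self (s := x ^ τ - 1) (by linarith) h0 h1
  rw [add_sub_cancel, ← rpow_mul hx.le, mul_comm τ l] at h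
  linarith

theorem one_add_mul_log_le_rpow {x : ℝ} (hx : 0 < x) (τ : ℝ) : 1 + τ * log x ≤ x ^ τ := by
  rw [rpow_def_of_pos hx]
  linarith [add_one_le_exp (log x * τ)]

theorem one_add_mul_log_lt_rpow {x τ : ℝ} (hx : 1 < x) (hτ : τ ≠ 0) :
    1 + τ * log x < x ^ τ := by
  rw [rpow_def_of_pos (by linarith)]
  linarith [add_one_lt_exp (mul_ne_zero (log_pos hx).ne' hτ)]

theorem mul_log_abs_one_sub_sq_lt {t τ : ℝ} (ht : 0 < t) (ht1 : t ≠ 1) (hτ : τ ≠ 0) :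
    τ * log |1 - t ^ 2| < |1 - t| ^ τ + (1 + t) ^ τ - 2 := by
  have h1 : 0 < |1 - t| := abs_pos.2 (sub_ne_zero.2 ht1.symm)
  have h2 : 0 < 1 + t := by linarith
  have h3 : |1 - t ^ 2| = |1 - t| * (1 + t) := by
    rw [show 1 - t ^ 2 = (1 - t) * (1 + t) by ring, abs_mul, abs_of_pos h2]
  rw [h3, log_mul h1.ne' h2.ne']
  linarith [one_add_mul_log_le_rpow h1 τ,
    one_add_mul_log_lt_rpow (x := 1 + t) (by linarith) hτ]

theorem abs_numerator_le_sq {t τ : ℝ} (ht : 0 < t) (ht2 : t ≤ 1 / 2) (hτ : τ ∈ Ioo (-1 : ℝ) 0) :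
    |(|1 - t| ^ τ + (1 + t) ^ τ - 2)| ≤ 3 * t ^ 2 := by
  obtain ⟨h1, h0⟩ := hτ
  have hlow := mul_log_abs_one_sub_sq_lt ht (by linarith) h0.ne
  have hlog : log |1 - t ^ 2| ≤ 0 := log_nonpos (abs_nonneg _) (by
    rw [abs_le]; constructor <;> nlinarith)
  have hpos : 0 ≤ |1 - t| ^ τ + (1 + t) ^ τ - 2 := by nlinarith
  rw [abs_of_nonneg hpos, abs_of_pos (by linarith : 0 < 1 - t)]
  have ha := rpow_mul_sub_one_le (x := 1 - t) (by linarith) (-1) (l := -τ)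
    (by linarith) (by linarith)
  have hb := rpow_mul_sub_one_le (x := 1 + t) (by linarith) (-1) (l := -τ)
    (by linarith) (by linarith)
  rw [neg_mul_neg, mul_one, rpow_neg_one] at ha hb
  have hinv : (1 - t)⁻¹ - 1 + ((1 + t)⁻¹ - 1) ≤ 3 * t ^ 2 := by
    have e1 : (1 : ℝ) - t ≠ 0 := by linarith
    have e2 : (1 : ℝ) + t ≠ 0 := by linarith
    have e : (1 - t)⁻¹ - 1 + ((1 + t)⁻¹ - 1) = 2 * t ^ 2 / ((1 - t) * (1 + t)) := by
      field_simp; ring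
    rw [e, div_le_iff₀ (by nlinarith)]
    nlinarith [mul_nonneg (sq_nonneg t) (by nlinarith : 0 ≤ 1 - 3 * t ^ 2)]
  nlinarith [sq_nonneg t]

theorem abs_numerator_le {t τ : ℝ} (ht : 0 < t) (hτ : τ ≤ 0) :
    |(|1 - t| ^ τ + (1 + t) ^ τ - 2)| ≤ |1 - t| ^ τ + 2 := by
  have h1 : 0 ≤ |1 - t| ^ τ := rpow_nonneg (abs_nonneg _) _
  have h2 : 0 ≤ (1 + t) ^ τ := rpow_nonneg (by linarith) _
  have h3 : (1 + t) ^ τ ≤ 1 := rpow_le_one_of_one_le_of_nonpos (by linarith) hτ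
  rw [abs_le]; constructor <;> linarith

theorem integrableOn_abs_one_sub_rpow {τ : ℝ} (hτ : -1 < τ) :
    IntegrableOn (fun t : ℝ => |1 - t| ^ τ) (Ioc (1 / 2) 2) := by
  rw [← intervalIntegrable_iff_integrableOn_Ioc_of_le (by norm_num)]
  have hl : IntervalIntegrable (fun t : ℝ => |1 - t| ^ τ) volume (1 / 2) 1 := by
    have h := (intervalIntegral.intervalIntegrable_rpow' (a := 1 / 2) (b := 0) hτ).comp_sub_left 1
    norm_num at h
    refine h.congr fun t ht => ?_
    rw [uIoc_of_le (by norm_num)] at ht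
    simp only [abs_of_nonneg (by linarith [ht.2] : 0 ≤ 1 - t)]
  have hr : IntervalIntegrable (fun t : ℝ => |1 - t| ^ τ) volume 1 2 := by
    have h := (intervalIntegral.intervalIntegrable_rpow' (a := 0) (b := 1) hτ).comp_sub_right 1
    norm_num at h
    refine h.congr fun t ht => ?_
    rw [uIoc_of_le (by norm_num)] at ht
    simp only [abs_sub_comm 1 t, abs_of_nonneg (by linarith [ht.1] : 0 ≤ t - 1)]
  exact hl.trans hr

theorem integrableOn_c_integrand {α τ : ℝ} (hα : α ∈ Ioo (0 : ℝ) 1) (hτ : τ ∈ Ioo (-1 : ℝ) 0) :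
    IntegrableOn (fun t : ℝ => (|1 - t| ^ τ + (1 + t) ^ τ - 2) / t ^ (1 + 2 * α)) (Ioi 0) := by
  obtain ⟨hα0, hα1⟩ := hα
  have hm : Measurable fun t : ℝ => (|1 - t| ^ τ + (1 + t) ^ τ - 2) / t ^ (1 + 2 * α) := by
    fun_prop
  have hnorm : ∀ t : ℝ, 0 < t → ‖(|1 - t| ^ τ + (1 + t) ^ τ - 2) / t ^ (1 + 2 * α)‖
      = |(|1 - t| ^ τ + (1 + t) ^ τ - 2)| / t ^ (1 + 2 * α) := fun t ht => by
    rw [norm_eq_abs, abs_div, abs_of_pos (rpow_pos_of_pos ht _)]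
  have h1 : IntegrableOn (fun t : ℝ => (|1 - t| ^ τ + (1 + t) ^ τ - 2) / t ^ (1 + 2 * α))
      (Ioc 0 (1 / 2)) := by
    have hg : IntegrableOn (fun t : ℝ => 3 * t ^ (1 - 2 * α)) (Ioc 0 (1 / 2)) := by
      rw [← intervalIntegrable_iff_integrableOn_Ioc_of_le (by norm_num)]
      exact (intervalIntegral.intervalIntegrable_rpow' (by linarith)).const_mul 3
    refine Integrable.mono' hg hm.aestronglyMeasurable
      (ae_restrict_of_forall_mem measurableSet_Ioc fun t ht => ?_)
    rw [hnorm t ht.1, div_le_iff₀ (rpow_pos_of_pos ht.1 _), mul_assoc, ← rpow_add ht.1,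
      show 1 - 2 * α + (1 + 2 * α) = (2 : ℕ) by push_cast; ring, rpow_natCast]
    exact abs_numerator_le_sq ht.1 ht.2 hτ
  have h2 : IntegrableOn (fun t : ℝ => (|1 - t| ^ τ + (1 + t) ^ τ - 2) / t ^ (1 + 2 * α))
      (Ioc (1 / 2) 2) := by
    have hg : IntegrableOn (fun t : ℝ => (|1 - t| ^ τ + 2) / (1 / 2) ^ (1 + 2 * α))
        (Ioc (1 / 2) 2) :=
      ((integrableOn_abs_one_sub_rpow hτ.1).add (integrableOn_const (by simp))).div_const _
    refine Integrable.mono' hg hm.aestronglyMeasurable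
      (ae_restrict_of_forall_mem measurableSet_Ioc fun t ht => ?_)
    have ht0 : 0 < t := by linarith [ht.1]
    rw [hnorm t ht0]
    have := abs_numerator_le ht0 hτ.2.le
    have hle := ht.1.le
    gcongr
  have h3 : IntegrableOn (fun t : ℝ => (|1 - t| ^ τ + (1 + t) ^ τ - 2) / t ^ (1 + 2 * α))
      (Ioi 2) := by
    have hg : IntegrableOn (fun t : ℝ => 3 * t ^ (-(1 + 2 * α))) (Ioi 2) :=
      (integrableOn_Ioi_rpow_of_lt (by linarith) (by norm_num)).const_mul 3
    refine Integrable.mono' hg hm.aestronglyMeasurable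
      (ae_restrict_of_forall_mem measurableSet_Ioi fun t (ht : 2 < t) => ?_)
    have ht0 : 0 < t := by linarith
    rw [hnorm t ht0, rpow_neg ht0.le, ← div_eq_mul_inv]
    have h4 : |1 - t| ^ τ ≤ 1 := rpow_le_one_of_one_le_of_nonpos
      (by rw [abs_sub_comm, abs_of_pos] <;> linarith) hτ.2.le
    have := abs_numerator_le ht0 hτ.2.le
    gcongr
    linarith
  have h := (h1.union h2).union h3
  rwa [Ioc_union_Ioc_eq_Ioc (by norm_num) (by norm_num), Ioc_union_Ioi_eq_Ioi (by norm_num)] at h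

theorem ae_restrict_Ioi_ne_one : ∀ᵐ t : ℝ ∂volume.restrict (Ioi 0), 0 < t ∧ t ≠ 1 :=
  (ae_restrict_mem measurableSet_Ioi).and (ae_restrict_of_ae (Measure.ae_ne volume 1))

theorem integrableOn_T_integrand {α : ℝ} (hα : α ∈ Ioo (0 : ℝ) 1) :
    IntegrableOn (fun t : ℝ => log |1 - t ^ 2| / t ^ (1 + 2 * α)) (Ioi 0) := by
  have hc := integrableOn_c_integrand hα (τ := -(1 / 2)) (by norm_num)
  have hg : IntegrableOn ((Ioi (1 : ℝ)).indicator fun t : ℝ => 2 / α * t ^ (-(1 + α))) (Ioi 0) := by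
    refine Integrable.integrableOn ((integrable_indicator_iff measurableSet_Ioi).2 ?_)
    exact (integrableOn_Ioi_rpow_of_lt (by linarith [hα.1]) one_pos).const_mul _
  refine Integrable.mono' ((hc.norm.const_mul 2).add hg)
    (Measurable.aestronglyMeasurable (by fun_prop)) ?_
  filter_upwards [ae_restrict_Ioi_ne_one] with t ⟨ht, ht1⟩
  have hp : 0 < t ^ (1 + 2 * α) := rpow_pos_of_pos ht _
  have hlow := mul_log_abs_one_sub_sq_lt ht ht1 (τ := -(1 / 2)) (by norm_num)
  simp only [Pi.add_apply, norm_eq_abs, abs_div, abs_of_pos hp]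
  have hN := le_abs_self (|1 - t| ^ (-(1 / 2) : ℝ) + (1 + t) ^ (-(1 / 2) : ℝ) - 2)
  set N := |(|1 - t| ^ (-(1 / 2) : ℝ) + (1 + t) ^ (-(1 / 2) : ℝ) - 2)|
  have hN0 : 0 ≤ N := abs_nonneg _
  rcases le_or_gt t 1 with h | h
  · rw [indicator_of_notMem (by simpa using h), add_zero, ← mul_div_assoc]
    have hlog : log |1 - t ^ 2| ≤ 0 := log_nonpos (abs_nonneg _) (by
      rw [abs_le]; constructor <;> nlinarith)
    gcongr
    rw [abs_of_nonpos hlog]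
    linarith
  · rw [indicator_of_mem (by simpa using h)]
    have hlog : log |1 - t ^ 2| ≤ 2 / α * t ^ α := by
      have h1 : log |1 - t ^ 2| ≤ log (t ^ 2) := by
        apply log_le_log (abs_pos.2 (by nlinarith))
        rw [abs_le]; constructor <;> nlinarith
      have h2 := log_le_rpow_div ht.le hα.1
      rw [log_pow] at h1
      push_cast at h1
      calc _ ≤ _ := h1
        _ ≤ 2 * (t ^ α / α) := by gcongr
        _ = _ := by ring
    have he : 2 / α * t ^ (-(1 + α)) = 2 / α * t ^ α / t ^ (1 + 2 * α) := by
      rw [mul_div_assoc, ← rpow_sub ht]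
      ring_nf
    have hq : 0 ≤ 2 / α * t ^ α := mul_nonneg (by have := hα.1; positivity) (rpow_nonneg ht.le _)
    rw [he, ← mul_div_assoc, ← add_div]
    gcongr
    rw [abs_le]; constructor <;> linarith

theorem mul_T_lt_c {α τ : ℝ} (hα : α ∈ Ioo (0 : ℝ) 1) (hτ : τ ∈ Ioo (-1 : ℝ) 0) :
    τ * T α < c α τ := by
  have hc := integrableOn_c_integrand hα hτ
  have hT := (integrableOn_T_integrand hα).const_mul τ
  have hpos : ∀ t : ℝ, 0 < t → t ≠ 1 → 0 < (|1 - t| ^ τ + (1 + t) ^ τ - 2) / t ^ (1 + 2 * α) -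
      τ * (log |1 - t ^ 2| / t ^ (1 + 2 * α)) := fun t ht ht1 => by
    rw [← mul_div_assoc, ← sub_div]
    exact div_pos (sub_pos.2 (mul_log_abs_one_sub_sq_lt ht ht1 hτ.2.ne)) (rpow_pos_of_pos ht _)
  have h : 0 < ∫ t in Ioi (0 : ℝ), ((|1 - t| ^ τ + (1 + t) ^ τ - 2) / t ^ (1 + 2 * α) -
      τ * (log |1 - t ^ 2| / t ^ (1 + 2 * α))) := by
    refine (setIntegral_pos_iff_support_of_nonneg_ae ?_ (hc.sub hT)).2 ?_
    · filter_upwards [ae_restrict_Ioi_ne_one] with t ht using (hpos t ht.1 ht.2).le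
    · refine lt_of_lt_of_le (b := volume (Ioi (1 : ℝ))) (by simp) (measure_mono fun t ht => ?_)
      have ht : 1 < t := ht
      exact ⟨(hpos t (by linarith) ht.ne').ne', mem_Ioi.2 (by linarith)⟩
  rw [integral_sub hc hT, integral_const_mul] at h
  exact sub_pos.1 h

theorem c_mul_le {α τ l : ℝ} (hα : α ∈ Ioo (0 : ℝ) 1) (hτ : τ ∈ Ioo (-1 : ℝ) 0)
    (hl : l ∈ Ioc (0 : ℝ) 1) : c α (l * τ) ≤ l * c α τ := by
  obtain ⟨h1, h0⟩ := hτ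
  obtain ⟨hl0, hl1⟩ := hl
  rw [c, c, ← integral_const_mul]
  refine integral_mono_ae (integrableOn_c_integrand hα ⟨by nlinarith, by nlinarith⟩)
    ((integrableOn_c_integrand hα ⟨h1, h0⟩).const_mul l) ?_
  filter_upwards [ae_restrict_Ioi_ne_one] with t ⟨ht, ht1⟩
  have ha := rpow_mul_sub_one_le (abs_pos.2 (sub_ne_zero.2 ht1.symm)) τ hl0.le hl1
  have hb := rpow_mul_sub_one_le (x := 1 + t) (by linarith) τ hl0.le hl1
  simp only [← mul_div_assoc]
  gcongr
  linarith

theorem continuousAt_c {α τ : ℝ} (hα : α ∈ Ioo (0 : ℝ) 1) (hτ : τ ∈ Ioo (-1 : ℝ) 0) :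
    ContinuousAt (fun a => c a τ) α := by
  obtain ⟨a, ha0, haα⟩ := exists_between hα.1
  obtain ⟨b, hαb, hb1⟩ := exists_between hα.2
  have hA := integrableOn_c_integrand ⟨ha0, by linarith⟩ hτ
  have hB := integrableOn_c_integrand ⟨by linarith [hα.1], hb1⟩ hτ
  refine continuousAt_of_dominated
    (.of_forall fun x => Measurable.aestronglyMeasurable (by fun_prop)) ?_ (hA.norm.add hB.norm) ?_
  · filter_upwards [Ioo_mem_nhds haα hαb] with x ⟨hx1, hx2⟩
    refine ae_restrict_of_forall_mem measurableSet_Ioi fun t (ht : 0 < t) => ?_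
    have hp : ∀ y : ℝ, 0 < t ^ y := rpow_pos_of_pos ht
    simp only [Pi.add_apply, norm_eq_abs, abs_div, abs_of_pos (hp _)]
    rcases le_total t 1 with h | h
    · refine le_add_of_nonneg_of_le (div_nonneg (abs_nonneg _) (hp _).le) ?_
      exact div_le_div_of_nonneg_left (abs_nonneg _) (hp _)
        (rpow_le_rpow_of_exponent_ge ht h (by linarith))
    · refine le_add_of_le_of_nonneg ?_ (div_nonneg (abs_nonneg _) (hp _).le)
      exact div_le_div_of_nonneg_left (abs_nonneg _) (hp _)
        (rpow_le_rpow_of_exponent_le h (by linarith))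
  · refine ae_restrict_of_forall_mem measurableSet_Ioi fun t (ht : 0 < t) => ?_
    refine continuousAt_const.div ?_ (rpow_pos_of_pos ht _).ne'
    exact continuousAt_const.rpow (by fun_prop) (.inl ht.ne')

theorem zeros_of_c_tendsto_zero (α₀ : ℝ) (hα₀ : α₀ ∈ Set.Ioo (0:ℝ) 1)
    (hzero : T α₀ = 0) (huniq : ∀ α ∈ Set.Ioo (0:ℝ) 1, T α = 0 → α = α₀) :
    ∀ ε > (0:ℝ), ∃ δ > (0:ℝ), ∀ α ∈ Set.Ioo (α₀ - δ) α₀,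
      ∀ τ ∈ Set.Ioo (-1:ℝ) 0, c α τ = 0 → -ε < τ := by
  intro ε hε
  rcases le_or_gt 1 ε with hε1 | hε1
  · exact ⟨1, one_pos, fun α _ τ hτ _ => by linarith [hτ.1]⟩
  have hmem : -ε ∈ Ioo (-1 : ℝ) 0 := ⟨by linarith, by linarith⟩
  have hpos : 0 < c α₀ (-ε) := by simpa [hzero] using mul_T_lt_c hα₀ hmem
  obtain ⟨δ, hδ, hball⟩ := Metric.eventually_nhds_iff.1
    ((continuousAt_c hα₀ hmem).eventually (lt_mem_nhds hpos))
  refine ⟨min δ α₀, lt_min hδ hα₀.1, fun α hα τ hτ hcz => ?_⟩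
  have hδα : α₀ - δ < α := by linarith [hα.1, min_le_left δ α₀]
  have hα0 : 0 < α := by linarith [hα.1, min_le_right δ α₀]
  have hcα : 0 < c α (-ε) := hball (by rw [dist_eq, abs_lt]; constructor <;> linarith [hα.2])
  by_contra! hle
  have hl : -ε / τ ∈ Ioc (0 : ℝ) 1 :=
    ⟨div_pos_of_neg_of_neg hmem.2 hτ.2, (div_le_one_of_neg hτ.2).2 hle⟩
  have h := c_mul_le ⟨hα0, hα.2.trans hα₀.2⟩ hτ hl
  rw [div_mul_cancel₀ _ hτ.2.ne, hcz, mul_zero] at h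
  linarith
end

section
/- For every α ∈ (0,1) and every τ ∈ (−1,0): the function t ↦ (χ_{(0,1)}(t)|1−t|^τ + (1+t)^τ − 2)/t^{1+2α} is Lebesgue integrable on (0,∞), the function t ↦ (t−1)^τ/t^{1+2α} is Lebesgue integrable on (1,∞), and c(α,τ) = C(α,τ) + ∫₁^∞ (t−1)^τ/t^{1+2α} dt; in particular c(α,τ) > C(α,τ). -/
open MeasureTheory Real Set

noncomputable def bigC (α τ : ℝ) : ℝ :=
  ∫ t in Set.Ioi (0:ℝ),
    ((Set.Ioo (0:ℝ) 1).indicator (fun s => |1 - s| ^ τ) t + (1 + t) ^ τ - 2) / t ^ (1 + 2 * α)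

lemma one_add_mul_le_rpow_one_add_of_nonpos {x τ : ℝ} (hx : -1 < x) (hx1 : x < 1)
    (hτ : τ ∈ Set.Ioo (-1:ℝ) 0) : 1 + τ * x ≤ (1 + x) ^ τ := by
  obtain ⟨h1, h0⟩ := hτ
  have hb := rpow_one_add_le_one_add_mul_self hx.le (p := -τ) (by linarith) (by linarith)
  have hpos : 0 < (1 + x) ^ (-τ) := rpow_pos_of_pos (by linarith) _
  have hinv : (1 + x) ^ τ = ((1 + x) ^ (-τ))⁻¹ := by
    rw [rpow_neg (by linarith), inv_inv]
  rw [hinv, le_inv_comm₀ (by nlinarith) hpos]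
  refine hb.trans ?_
  rw [← one_div, le_div_iff₀ (by nlinarith)]
  nlinarith [sq_nonneg (τ * x)]

lemma rpow_one_add_le_of_nonpos {x τ : ℝ} (hx : -1 < x)
    (hτ : τ ∈ Set.Ioo (-1:ℝ) 0) : (1 + x) ^ τ ≤ 1 + τ * (x / (1 + x)) := by
  obtain ⟨h1, h0⟩ := hτ
  have hx' : 0 < 1 + x := by linarith
  have hy : -1 ≤ -(x / (1 + x)) := by
    rw [neg_le_neg_iff, div_le_one hx']; linarith
  have hb := rpow_one_add_le_one_add_mul_self hy (p := -τ) (by linarith) (by linarith)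
  have he : 1 + -(x / (1 + x)) = (1 + x)⁻¹ := by field_simp; ring
  rw [he, inv_rpow hx'.le, rpow_neg hx'.le, inv_inv] at hb
  linarith

lemma abs_second_difference_rpow_le {t τ : ℝ} (ht : 0 < t) (ht2 : t ≤ 1 / 2)
    (hτ : τ ∈ Set.Ioo (-1:ℝ) 0) : |(1 - t) ^ τ + (1 + t) ^ τ - 2| ≤ 3 * t ^ 2 := by
  have l1 := one_add_mul_le_rpow_one_add_of_nonpos (x := t) (by linarith) (by linarith) hτ
  have l2 := one_add_mul_le_rpow_one_add_of_nonpos (x := -t) (by linarith) (by linarith) hτ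
  have u1 := rpow_one_add_le_of_nonpos (x := t) (by linarith) hτ
  have u2 := rpow_one_add_le_of_nonpos (x := -t) (by linarith) hτ
  rw [← sub_eq_add_neg] at l2 u2
  have hd : (-t) / (1 - t) + t / (1 + t) = -(2 * t ^ 2 / (1 - t ^ 2)) := by
    have : 1 - t ≠ 0 := by linarith
    have : 1 + t ≠ 0 := by linarith
    have : 1 - t ^ 2 ≠ 0 := by nlinarith
    field_simp
    ring
  have hq : 2 * t ^ 2 / (1 - t ^ 2) ≤ 3 * t ^ 2 := by
    rw [div_le_iff₀ (by nlinarith)]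
    nlinarith [sq_nonneg t, mul_nonneg (sq_nonneg t) (show (0:ℝ) ≤ 1 / 4 - t ^ 2 by nlinarith)]
  have hq0 : 0 ≤ 2 * t ^ 2 / (1 - t ^ 2) := div_nonneg (by positivity) (by nlinarith)
  have hs : τ * (-t / (1 - t)) + τ * (t / (1 + t)) = (-τ) * (2 * t ^ 2 / (1 - t ^ 2)) := by
    rw [← mul_add, hd]; ring
  have : (-τ) * (2 * t ^ 2 / (1 - t ^ 2)) ≤ 1 * (2 * t ^ 2 / (1 - t ^ 2)) :=
    mul_le_mul_of_nonneg_right (by linarith [hτ.1]) hq0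
  rw [abs_le]
  constructor <;> nlinarith [sq_nonneg t]

lemma measurable_bigC_integrand (α τ : ℝ) : Measurable (fun t : ℝ =>
    ((Set.Ioo (0:ℝ) 1).indicator (fun s => |1 - s| ^ τ) t + (1 + t) ^ τ - 2)
      / t ^ (1 + 2 * α)) := by
  have h : Measurable ((Set.Ioo (0:ℝ) 1).indicator (fun s : ℝ => |1 - s| ^ τ)) :=
    Measurable.indicator (by fun_prop) measurableSet_Ioo
  fun_prop

lemma integrableOn_bigC_integrand {α τ : ℝ} (hα : α ∈ Set.Ioo (0:ℝ) 1)
    (hτ : τ ∈ Set.Ioo (-1:ℝ) 0) :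
    IntegrableOn (fun t : ℝ =>
      ((Set.Ioo (0:ℝ) 1).indicator (fun s => |1 - s| ^ τ) t + (1 + t) ^ τ - 2)
        / t ^ (1 + 2 * α)) (Set.Ioi (0:ℝ)) := by
  have hm := measurable_bigC_integrand α τ
  have hle (t : ℝ) (ht : 0 < t) : (1 + t) ^ τ ≤ 1 :=
    rpow_le_one_of_one_le_of_nonpos (by linarith) hτ.2.le
  have hsplit : Set.Ioi (0:ℝ) = Set.Ioc 0 (1 / 2) ∪ Set.Ioc (1 / 2) 1 ∪ Set.Ioi 1 := by
    rw [Ioc_union_Ioc_eq_Ioc (by norm_num) (by norm_num), Ioc_union_Ioi_eq_Ioi (by norm_num)]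
  rw [hsplit]
  refine IntegrableOn.union (IntegrableOn.union ?_ ?_) ?_
  · have hg : IntegrableOn (fun t : ℝ => 3 * t ^ (1 - 2 * α)) (Set.Ioc 0 (1 / 2)) :=
      ((intervalIntegrable_iff_integrableOn_Ioc_of_le (by norm_num)).1
        (intervalIntegral.intervalIntegrable_rpow' (by linarith [hα.2]))).const_mul 3
    refine Integrable.mono' hg hm.aestronglyMeasurable ?_
    filter_upwards [ae_restrict_mem measurableSet_Ioc] with t ht
    have ht1 : t ∈ Set.Ioo (0:ℝ) 1 := ⟨ht.1, by linarith [ht.2]⟩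
    have hpow : (0:ℝ) < t ^ (1 + 2 * α) := rpow_pos_of_pos ht.1 _
    rw [indicator_of_mem ht1, abs_of_pos (by linarith [ht1.2] : 0 < 1 - t), norm_eq_abs, abs_div,
      abs_of_pos hpow, div_le_iff₀ hpow, mul_assoc, ← rpow_add ht.1,
      show 1 - 2 * α + (1 + 2 * α) = (2 : ℕ) by push_cast; ring, rpow_natCast]
    exact abs_second_difference_rpow_le ht.1 ht.2 hτ
  · have hone : IntegrableOn (fun t : ℝ => (1 - t) ^ τ) (Set.Ioc (1 / 2) 1) := by
      have h := (intervalIntegral.intervalIntegrable_rpow' (a := 1 / 2) (b := 0) hτ.1).comp_sub_left 1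
      norm_num at h
      exact (intervalIntegrable_iff_integrableOn_Ioc_of_le (by norm_num)).1 h
    have hg : IntegrableOn (fun t : ℝ => ((1 - t) ^ τ + 2) / (1 / 2) ^ (1 + 2 * α))
        (Set.Ioc (1 / 2) 1) :=
      (hone.add (integrableOn_const (by simp))).div_const _
    refine Integrable.mono' hg hm.aestronglyMeasurable ?_
    filter_upwards [ae_restrict_mem measurableSet_Ioc] with t ht
    have ht0 : 0 < t := by linarith [ht.1]
    have hpow : (0:ℝ) < t ^ (1 + 2 * α) := rpow_pos_of_pos ht0 _
    have hnn : 0 ≤ (1 - t) ^ τ := rpow_nonneg (by linarith [ht.2]) _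
    have hi0 : 0 ≤ (Set.Ioo (0:ℝ) 1).indicator (fun s => |1 - s| ^ τ) t :=
      indicator_nonneg (fun s _ => by positivity) t
    have hi1 : (Set.Ioo (0:ℝ) 1).indicator (fun s => |1 - s| ^ τ) t ≤ (1 - t) ^ τ :=
      indicator_apply_le' (fun _ => by rw [abs_of_nonneg (by linarith [ht.2])]) (fun _ => hnn)
    have h1 := hle t ht0
    have h0 : 0 ≤ (1 + t) ^ τ := by positivity
    rw [norm_eq_abs, abs_div, abs_of_pos hpow]
    gcongr
    · rw [abs_le]; constructor <;> linarith
    · linarith [hα.1]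
    · exact ht.1.le
  · have hg : IntegrableOn (fun t : ℝ => 2 * t ^ (-(1 + 2 * α))) (Set.Ioi 1) :=
      (integrableOn_Ioi_rpow_of_lt (by linarith [hα.1]) one_pos).const_mul 2
    refine Integrable.mono' hg hm.aestronglyMeasurable ?_
    filter_upwards [ae_restrict_mem measurableSet_Ioi] with t (ht : 1 < t)
    have ht0 : 0 < t := by linarith
    have hpow : (0:ℝ) < t ^ (1 + 2 * α) := rpow_pos_of_pos ht0 _
    have h1 := hle t ht0
    have h0 : 0 ≤ (1 + t) ^ τ := by positivity
    rw [indicator_of_notMem (fun h => by linarith [h.2]), norm_eq_abs, abs_div, abs_of_pos hpow,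
      rpow_neg ht0.le, ← div_eq_mul_inv]
    gcongr
    rw [abs_le]; constructor <;> linarith

lemma integrableOn_sub_one_rpow_div {α τ : ℝ} (hα : α ∈ Set.Ioo (0:ℝ) 1)
    (hτ : τ ∈ Set.Ioo (-1:ℝ) 0) :
    IntegrableOn (fun t : ℝ => (t - 1) ^ τ / t ^ (1 + 2 * α)) (Set.Ioi (1:ℝ)) := by
  have hm : Measurable (fun t : ℝ => (t - 1) ^ τ / t ^ (1 + 2 * α)) := by fun_prop
  rw [← Ioc_union_Ioi_eq_Ioi (show (1:ℝ) ≤ 2 by norm_num)]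
  refine IntegrableOn.union ?_ ?_
  · have hg : IntegrableOn (fun t : ℝ => (t - 1) ^ τ) (Set.Ioc 1 2) := by
      have h := (intervalIntegral.intervalIntegrable_rpow' (a := 0) (b := 1) hτ.1).comp_sub_right 1
      norm_num at h
      exact (intervalIntegrable_iff_integrableOn_Ioc_of_le (by norm_num)).1 h
    refine Integrable.mono' hg hm.aestronglyMeasurable ?_
    filter_upwards [ae_restrict_mem measurableSet_Ioc] with t ht
    have hnn : 0 ≤ (t - 1) ^ τ := rpow_nonneg (by linarith [ht.1]) _
    have hpow : 1 ≤ t ^ (1 + 2 * α) := one_le_rpow ht.1.le (by linarith [hα.1])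
    rw [norm_eq_abs, abs_of_nonneg (by positivity)]
    exact div_le_self hnn hpow
  · have hg : IntegrableOn (fun t : ℝ => t ^ (-(1 + 2 * α))) (Set.Ioi 2) :=
      integrableOn_Ioi_rpow_of_lt (by linarith [hα.1]) two_pos
    refine Integrable.mono' hg hm.aestronglyMeasurable ?_
    filter_upwards [ae_restrict_mem measurableSet_Ioi] with t (ht : 2 < t)
    have ht0 : 0 < t := by linarith
    have hnn : 0 ≤ (t - 1) ^ τ := rpow_nonneg (by linarith) _
    have h1 : (t - 1) ^ τ ≤ 1 := rpow_le_one_of_one_le_of_nonpos (by linarith) hτ.2.le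
    rw [norm_eq_abs, abs_of_nonneg (by positivity), rpow_neg ht0.le, ← one_div]
    gcongr

lemma integral_sub_one_rpow_div_pos {α τ : ℝ} (hα : α ∈ Set.Ioo (0:ℝ) 1)
    (hτ : τ ∈ Set.Ioo (-1:ℝ) 0) :
    0 < ∫ t in Set.Ioi (1:ℝ), (t - 1) ^ τ / t ^ (1 + 2 * α) := by
  have hpos (t : ℝ) (ht : t ∈ Set.Ioi (1:ℝ)) : 0 < (t - 1) ^ τ / t ^ (1 + 2 * α) :=
    div_pos (rpow_pos_of_pos (sub_pos.2 ht) _) (rpow_pos_of_pos (one_pos.trans ht) _)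
  rw [setIntegral_pos_iff_support_of_nonneg_ae
    ((ae_restrict_mem measurableSet_Ioi).mono fun t ht => (hpos t ht).le)
    (integrableOn_sub_one_rpow_div hα hτ),
    inter_eq_right.2 fun t ht => Function.mem_support.2 (hpos t ht).ne']
  simp

theorem c_eq_bigC_add (α τ : ℝ) (hα : α ∈ Set.Ioo (0:ℝ) 1) (hτ : τ ∈ Set.Ioo (-1:ℝ) 0) :
    MeasureTheory.IntegrableOn
      (fun t : ℝ =>
        ((Set.Ioo (0:ℝ) 1).indicator (fun s => |1 - s| ^ τ) t + (1 + t) ^ τ - 2)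
          / t ^ (1 + 2 * α)) (Set.Ioi (0:ℝ)) ∧
    MeasureTheory.IntegrableOn
      (fun t : ℝ => (t - 1) ^ τ / t ^ (1 + 2 * α)) (Set.Ioi (1:ℝ)) ∧
    c α τ = bigC α τ + ∫ t in Set.Ioi (1:ℝ), (t - 1) ^ τ / t ^ (1 + 2 * α) ∧
    bigC α τ < c α τ := by
  have hG := integrableOn_bigC_integrand hα hτ
  have hH := integrableOn_sub_one_rpow_div hα hτ
  have heq : c α τ = bigC α τ + ∫ t in Set.Ioi (1:ℝ), (t - 1) ^ τ / t ^ (1 + 2 * α) := by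
    have hH' : IntegrableOn ((Set.Ioi (1:ℝ)).indicator
        (fun t : ℝ => (t - 1) ^ τ / t ^ (1 + 2 * α))) (Set.Ioi (0:ℝ)) :=
      ((integrable_indicator_iff measurableSet_Ioi).2 hH).integrableOn
    have hinter : Set.Ioi (0:ℝ) ∩ Set.Ioi 1 = Set.Ioi 1 :=
      inter_eq_right.2 (Ioi_subset_Ioi zero_le_one)
    rw [← hinter, ← setIntegral_indicator measurableSet_Ioi, bigC, ← integral_add hG hH', c]
    refine setIntegral_congr_ae measurableSet_Ioi ?_
    filter_upwards [Measure.ae_ne volume (1:ℝ)] with t hne (ht : 0 < t)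
    rcases lt_or_gt_of_ne hne with h | h
    · rw [indicator_of_mem (show t ∈ Set.Ioo (0:ℝ) 1 from ⟨ht, h⟩),
        indicator_of_notMem (show t ∉ Set.Ioi (1:ℝ) from h.le.not_gt), add_zero]
    · rw [indicator_of_notMem (fun hm => h.not_gt hm.2),
        indicator_of_mem (show t ∈ Set.Ioi (1:ℝ) from h), abs_of_neg (by linarith), neg_sub]
      ring
  refine ⟨hG, hH, heq, ?_⟩
  rw [heq]
  exact lt_add_of_pos_right _ (integral_sub_one_rpow_div_pos hα hτ)
end

section
/- Let N ≥ 2 be an integer, α ∈ (0,1) and τ ∈ (−1,0). Writing points of ℝ^N as z = (z₁, z') with z₁ ∈ ℝ and z' ∈ ℝ^{N−1}, and |·| the Euclidean norm, one has ∫_{ℝ^N} (|1−z₁|^τ + |1+z₁|^τ − 2)/|z|^{N+2α} dz = 2 c(α,τ) ∫_{ℝ^{N−1}} (1 + |z'|²)^{−(N+2α)/2} dz'. -/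
open MeasureTheory Real Set

section Shear

variable {E : Type*} [NormedAddCommGroup E] [NormedSpace ℝ E] [FiniteDimensional ℝ E]
  [MeasurableSpace E] [BorelSpace E] (μ : Measure E) [μ.IsAddHaarMeasure]

theorem lintegral_comp_smul_haar (g : E → ENNReal) (hg : Measurable g) {t : ℝ} (ht : t ≠ 0) :
    ENNReal.ofReal (|t| ^ Module.finrank ℝ E) * ∫⁻ w, g (t • w) ∂μ = ∫⁻ w, g w ∂μ := by
  have hmeas : Measurable fun w : E => t • w := measurable_const_smul t
  rw [← lintegral_map hg hmeas, Measure.map_addHaar_smul μ ht, lintegral_smul_measure,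
    smul_eq_mul, ← mul_assoc, ← ENNReal.ofReal_mul (by positivity), abs_inv, abs_pow,
    mul_inv_cancel₀ (by positivity), ENNReal.ofReal_one, one_mul]

/-- The shear `(t, w) ↦ (t, t • w)` has Jacobian `|t| ^ dim E`. -/
theorem map_withDensity_shear :
    (((volume : Measure ℝ).prod μ).withDensity
      fun p => ENNReal.ofReal (|p.1| ^ Module.finrank ℝ E)).map (fun p => (p.1, p.1 • p.2))
      = (volume : Measure ℝ).prod μ := by
  have hT : Measurable fun p : ℝ × E => (p.1, p.1 • p.2) := by fun_prop
  have hd : Measurable fun p : ℝ × E => ENNReal.ofReal (|p.1| ^ Module.finrank ℝ E) := by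
    fun_prop
  refine Measure.ext_of_lintegral _ fun g hg => ?_
  have hgT : Measurable fun p : ℝ × E => g (p.1, p.1 • p.2) := hg.comp hT
  rw [lintegral_map hg hT, lintegral_withDensity_eq_lintegral_mul _ hd hgT,
    lintegral_prod _ (hd.mul hgT).aemeasurable, lintegral_prod _ hg.aemeasurable]
  refine lintegral_congr_ae ?_
  filter_upwards [Measure.ae_ne volume (0 : ℝ)] with t ht
  have hgt : Measurable fun w : E => g (t, w) := hg.comp measurable_prodMk_left
  simp only [Pi.mul_apply]
  exact (lintegral_const_mul _ (hgt.comp (measurable_const_smul t))).trans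
    (lintegral_comp_smul_haar μ _ hgt ht)

theorem integral_prod_shear (F : ℝ × E → ℝ) (hF : Measurable F) :
    ∫ p, F p ∂((volume : Measure ℝ).prod μ)
      = ∫ p, |p.1| ^ Module.finrank ℝ E * F (p.1, p.1 • p.2) ∂((volume : Measure ℝ).prod μ) := by
  have hT : Measurable fun p : ℝ × E => (p.1, p.1 • p.2) := by fun_prop
  conv_lhs => rw [← map_withDensity_shear μ]
  rw [integral_map hT.aemeasurable hF.aestronglyMeasurable,
    integral_withDensity_eq_integral_toReal_smul (by fun_prop) (by simp)]
  refine integral_congr_ae (.of_forall fun p => ?_)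
  simp only [smul_eq_mul]
  rw [ENNReal.toReal_ofReal (by positivity)]

end Shear

/-- Splitting off the first coordinate of a Euclidean space, as a measurable equivalence. -/
noncomputable def euclideanSpaceSplit (n : ℕ) :
    EuclideanSpace ℝ (Fin (n + 1)) ≃ᵐ ℝ × EuclideanSpace ℝ (Fin n) :=
  ((MeasurableEquiv.toLp 2 (Fin (n + 1) → ℝ)).symm.trans
    (MeasurableEquiv.piFinSuccAbove (fun _ => ℝ) 0)).trans
    ((MeasurableEquiv.refl ℝ).prodCongr (MeasurableEquiv.toLp 2 (Fin n → ℝ)))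

theorem measurePreserving_euclideanSpaceSplit (n : ℕ) :
    MeasurePreserving (euclideanSpaceSplit n) volume
      ((volume : Measure ℝ).prod volume) :=
  ((MeasurePreserving.id (volume : Measure ℝ)).prod (PiLp.volume_preserving_toLp (Fin n))).comp
    ((volume_preserving_piFinSuccAbove (fun _ => ℝ) 0).comp
      (PiLp.volume_preserving_ofLp (Fin (n + 1))))

theorem euclideanSpaceSplit_fst (n : ℕ) (z : EuclideanSpace ℝ (Fin (n + 1))) :
    (euclideanSpaceSplit n z).1 = z 0 := rfl

theorem sq_norm_eq_euclideanSpaceSplit (n : ℕ) (z : EuclideanSpace ℝ (Fin (n + 1))) :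
    ‖z‖ ^ 2 = (euclideanSpaceSplit n z).1 ^ 2 + ‖(euclideanSpaceSplit n z).2‖ ^ 2 := by
  rw [EuclideanSpace.real_norm_sq_eq, EuclideanSpace.real_norm_sq_eq, Fin.sum_univ_succ]
  rfl

theorem abs_pow_mul_div_rpow_shear {E : Type*} [NormedAddCommGroup E] [NormedSpace ℝ E]
    (n : ℕ) (α : ℝ) {t : ℝ} (ht : t ≠ 0) (a : ℝ) (w : E) :
    |t| ^ n * (a / (t ^ 2 + ‖t • w‖ ^ 2) ^ (((n + 1 : ℕ) + 2 * α) / 2))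
      = a / |t| ^ (1 + 2 * α) * (1 + ‖w‖ ^ 2) ^ (-(((n + 1 : ℕ) + 2 * α) / 2)) := by
  have h0 : 0 < |t| := abs_pos.mpr ht
  have hsum : t ^ 2 + ‖t • w‖ ^ 2 = |t| ^ (2 : ℝ) * (1 + ‖w‖ ^ 2) := by
    rw [norm_smul, Real.norm_eq_abs, rpow_two, mul_pow, sq_abs]; ring
  have hexp : (2 : ℝ) * (((n + 1 : ℕ) + 2 * α) / 2) = n + (1 + 2 * α) := by push_cast; ring
  rw [hsum, mul_rpow (by positivity) (by positivity), ← rpow_mul h0.le, hexp,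
    rpow_add h0, rpow_natCast, rpow_neg (by positivity)]
  field_simp

theorem integral_euclidean_eq (N : ℕ) (hN : 2 ≤ N) (α τ : ℝ)
    (hα : α ∈ Set.Ioo (0:ℝ) 1) (hτ : τ ∈ Set.Ioo (-1:ℝ) 0) :
    (∫ z : EuclideanSpace ℝ (Fin N),
        (|1 - z ⟨0, by omega⟩| ^ τ + |1 + z ⟨0, by omega⟩| ^ τ - 2)
          / ‖z‖ ^ ((N : ℝ) + 2 * α))
      = 2 * c α τ *
        ∫ z' : EuclideanSpace ℝ (Fin (N - 1)),
          (1 + ‖z'‖ ^ 2) ^ (-(((N : ℝ) + 2 * α) / 2)) := by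
  obtain ⟨n, rfl⟩ : ∃ n, N = n + 1 := ⟨N - 1, by omega⟩
  rw [Nat.add_sub_cancel]
  set f : ℝ → ℝ := fun t => |1 - t| ^ τ + |1 + t| ^ τ - 2 with hf
  have hf_zero : f 0 = 0 := by norm_num [hf]
  have hf_abs (t : ℝ) : f |t| = f t := by
    rcases abs_choice t with h | h <;> rw [h]
    simp only [hf, sub_neg_eq_add, ← sub_eq_add_neg]
    ring
  set F : ℝ × EuclideanSpace ℝ (Fin n) → ℝ := fun p =>
    f p.1 / (p.1 ^ 2 + ‖p.2‖ ^ 2) ^ (((n + 1 : ℕ) + 2 * α) / 2) with hF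
  have hFm : Measurable F := by fun_prop
  have hFe (z : EuclideanSpace ℝ (Fin (n + 1))) :
      (|1 - z ⟨0, by omega⟩| ^ τ + |1 + z ⟨0, by omega⟩| ^ τ - 2)
        / ‖z‖ ^ (((n + 1 : ℕ) : ℝ) + 2 * α) = F (euclideanSpaceSplit n z) := by
    simp only [hF]
    rw [← sq_norm_eq_euclideanSpaceSplit, ← rpow_two, ← rpow_mul (norm_nonneg z),
      mul_div_cancel₀ _ (two_ne_zero)]
    rfl
  have hshear (p : ℝ × EuclideanSpace ℝ (Fin n)) :
      |p.1| ^ n * F (p.1, p.1 • p.2)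
        = f p.1 / |p.1| ^ (1 + 2 * α) * (1 + ‖p.2‖ ^ 2) ^ (-(((n + 1 : ℕ) + 2 * α) / 2)) := by
    rcases eq_or_ne p.1 0 with h | h
    · simp [hF, h, hf_zero]
    · exact abs_pow_mul_div_rpow_shear n α h _ _
  have hline : ∫ t, f t / |t| ^ (1 + 2 * α) = 2 * c α τ := by
    have := integral_comp_abs (f := fun t => f t / t ^ (1 + 2 * α))
    simp only [hf_abs] at this
    rw [this, c]
    congr 1
    refine setIntegral_congr_fun measurableSet_Ioi fun t (ht : 0 < t) => ?_
    simp only [hf]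
    rw [abs_of_pos (by linarith : 0 < 1 + t)]
  simp_rw [hFe]
  rw [(measurePreserving_euclideanSpaceSplit n).integral_comp', integral_prod_shear _ F hFm,
    finrank_euclideanSpace_fin]
  simp_rw [hshear]
  rw [integral_prod_mul (fun t : ℝ => f t / |t| ^ (1 + 2 * α))
    (fun w : EuclideanSpace ℝ (Fin n) => (1 + ‖w‖ ^ 2) ^ (-(((n + 1 : ℕ) + 2 * α) / 2))), hline]
end

section
/- There exists a constant M > 0 such that for every α ∈ (0, 1/2), the function t ↦ |log|1−t²||/t^{1+2α} is Lebesgue integrable on (0,2) and ∫₀² |log|1−t²||/t^{1+2α} dt ≤ M. -/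
open MeasureTheory Real Set

theorem integrableOn_abs_log_one_sub_add_abs_log_one_add :
    IntegrableOn (fun t : ℝ => 2 + 4 * (|Real.log (1 - t)| + |Real.log (1 + t)|))
      (Ioo (0:ℝ) 2) := by
  have hsub : IntervalIntegrable (fun t : ℝ => Real.log (1 - t)) volume 0 2 := by
    have h := (intervalIntegral.intervalIntegrable_log' (a := 1) (b := -1)).comp_sub_left 1
    norm_num at h
    exact h
  have hadd : IntervalIntegrable (fun t : ℝ => Real.log (1 + t)) volume 0 2 := by
    have h := (intervalIntegral.intervalIntegrable_log' (a := 1) (b := 3)).comp_add_left 1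
    norm_num at h
    exact h
  have hg : IntervalIntegrable
      (fun t : ℝ => 2 + 4 * (|Real.log (1 - t)| + |Real.log (1 + t)|)) volume 0 2 :=
    intervalIntegrable_const.add ((hsub.abs.add hadd.abs).const_mul 4)
  exact ((intervalIntegrable_iff_integrableOn_Ioc_of_le (by norm_num)).1 hg).mono_set
    Ioo_subset_Ioc_self

theorem abs_log_one_sub_sq_le (t : ℝ) :
    |Real.log (1 - t ^ 2)| ≤ |Real.log (1 - t)| + |Real.log (1 + t)| := by
  rcases eq_or_ne (1 - t ^ 2) 0 with h | h
  · rw [h, Real.log_zero, abs_zero]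
    positivity
  · have hfac : 1 - t ^ 2 = (1 - t) * (1 + t) := by ring
    rw [hfac] at h ⊢
    rw [Real.log_mul (left_ne_zero_of_mul h) (right_ne_zero_of_mul h)]
    exact abs_add_le _ _

theorem abs_log_one_sub_sq_div_rpow_le {t p : ℝ} (ht : 0 < t) (hp₀ : 0 ≤ p) (hp : p ≤ 2) :
    |Real.log (1 - t ^ 2)| / t ^ p ≤
      2 + 4 * (|Real.log (1 - t)| + |Real.log (1 + t)|) := by
  have hpos : 0 < t ^ p := Real.rpow_pos_of_pos ht p
  rw [div_le_iff₀ hpos]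
  have hA := abs_log_one_sub_sq_le t
  have hB : 0 ≤ |Real.log (1 - t)| + |Real.log (1 + t)| := by positivity
  rcases le_total t (1 / 2) with h | h
  · have hpow : t ^ 2 ≤ t ^ p := by
      rw [← Real.rpow_two]
      exact Real.rpow_le_rpow_of_exponent_ge ht (by linarith) hp
    have hlog : |Real.log (1 - t ^ 2)| ≤ 2 * t ^ 2 := by
      have hs : t ^ 2 ≤ 1 / 4 := by nlinarith
      have h1 : 0 < 1 - t ^ 2 := by linarith
      rw [abs_of_nonpos (Real.log_nonpos h1.le (by nlinarith))]
      have h2 := Real.one_sub_inv_le_log_of_pos h1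
      have h3 : (1 - t ^ 2)⁻¹ ≤ 1 + 2 * t ^ 2 := by
        rw [inv_le_iff_one_le_mul₀ h1]
        nlinarith [sq_nonneg t]
      linarith
    nlinarith
  · have hpow : 1 / 4 ≤ t ^ p := by
      calc (1 / 4 : ℝ) = (1 / 2 : ℝ) ^ (2 : ℝ) := by norm_num
        _ ≤ (1 / 2 : ℝ) ^ p :=
          Real.rpow_le_rpow_of_exponent_ge (by norm_num) (by norm_num) hp
        _ ≤ t ^ p := Real.rpow_le_rpow (by norm_num) h hp₀
    nlinarith

theorem uniform_bound_near_zero :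
    ∃ M > (0:ℝ), ∀ α ∈ Set.Ioo (0:ℝ) (1/2 : ℝ),
      MeasureTheory.IntegrableOn
        (fun t : ℝ => |Real.log (|1 - t ^ 2|)| / t ^ (1 + 2 * α)) (Set.Ioo (0:ℝ) 2) ∧
      (∫ t in Set.Ioo (0:ℝ) 2, |Real.log (|1 - t ^ 2|)| / t ^ (1 + 2 * α)) ≤ M := by
  have hg := integrableOn_abs_log_one_sub_add_abs_log_one_add
  refine ⟨(∫ t in Ioo (0:ℝ) 2, (2 + 4 * (|Real.log (1 - t)| + |Real.log (1 + t)|))) + 1,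
    add_pos_of_nonneg_of_pos (integral_nonneg fun t => by positivity) one_pos, ?_⟩
  rintro α ⟨hα₀, hα⟩
  simp only [Real.log_abs]
  have hle : ∀ t ∈ Ioo (0:ℝ) 2, |Real.log (1 - t ^ 2)| / t ^ (1 + 2 * α) ≤
      2 + 4 * (|Real.log (1 - t)| + |Real.log (1 + t)|) := fun t ht =>
    abs_log_one_sub_sq_div_rpow_le ht.1 (by linarith) (by linarith)
  have hf : IntegrableOn (fun t : ℝ => |Real.log (1 - t ^ 2)| / t ^ (1 + 2 * α))
      (Ioo (0:ℝ) 2) := by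
    refine Integrable.mono' hg (Measurable.aestronglyMeasurable (by fun_prop)) ?_
    filter_upwards [ae_restrict_mem measurableSet_Ioo] with t ht
    have hpos : 0 < t ^ (1 + 2 * α) := Real.rpow_pos_of_pos ht.1 _
    rw [Real.norm_of_nonneg (by positivity)]
    exact hle t ht
  exact ⟨hf, (setIntegral_mono_on hf hg measurableSet_Ioo hle).trans (by linarith)⟩
end
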